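/- Lemma 3.2. Suppose b₁,b₂>0 and conditions (V), (F_0), (F_1), (F_2), (F_3), (F_4) hold. Then every Cerami sequence {(u_n,v_n)}⊂E for Φ has a subsequence converging in the norm of E to some (u,v)∈E, i.e. ‖u_{n_j}−u‖_{E₁}→0 and ‖v_{n_j}−v‖_{E₂}→0. -/

import Mathlib

open Filter Topology

/-- A connected, locally finite weighted graph `G = (V, E)` with symmetric positive edge
weights `w` (vanishing off edges) and a vertex measure `mu` with positive lower bound
`mumin`. -/
structure WeightedGraph (V : Type*) where
  G : SimpleGraph V
  connected : G.Connected
  locallyFinite : ∀ x : V, (G.neighborSet x).Finite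
  w : V → V → ℝ
  w_symm : ∀ x y, w x y = w y x
  w_pos : ∀ x y, G.Adj x y → 0 < w x y
  w_eq_zero : ∀ x y, ¬ G.Adj x y → w x y = 0
  mu : V → ℝ
  mumin : ℝ
  mumin_pos : 0 < mumin
  mu_ge : ∀ x, mumin ≤ mu x

namespace WeightedGraph

variable {V : Type*} (S : WeightedGraph V)

/-- `∫_V φ dμ = Σ_{x ∈ V} φ(x) μ(x)`. -/
noncomputable def integral (φ : V → ℝ) : ℝ := ∑' x, φ x * S.mu x

/-- The graph Laplacian `Δu(x) = (1/μ(x)) Σ_{y ∼ x} w_{xy} (u(y) - u(x))`. -/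
noncomputable def lap (u : V → ℝ) (x : V) : ℝ :=
  (1 / S.mu x) * ∑' y, S.w x y * (u y - u x)

/-- `|∇u|²(x) = (1/(2μ(x))) Σ_{y ∼ x} w_{xy} (u(y) - u(x))²`. -/
noncomputable def gradSq (u : V → ℝ) (x : V) : ℝ :=
  (1 / (2 * S.mu x)) * ∑' y, S.w x y * (u y - u x) ^ 2

/-- `∇u·∇v(x) = (1/(2μ(x))) Σ_{y ∼ x} w_{xy} (u(y) - u(x))(v(y) - v(x))`. -/
noncomputable def gradDot (u v : V → ℝ) (x : V) : ℝ :=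
  (1 / (2 * S.mu x)) * ∑' y, S.w x y * (u y - u x) * (v y - v x)

/-- The `L^r` norm `‖u‖_r = (∫_V |u|^r dμ)^{1/r}` for `1 ≤ r < ∞`. -/
noncomputable def normLr (r : ℝ) (u : V → ℝ) : ℝ :=
  (S.integral fun x => |u x| ^ r) ^ (1 / r)

/-- The density `|Δu|² + a |∇u|² + V(x) u²` defining the norm of the space `E_i`. -/
noncomputable def energyDensity (a : ℝ) (Vp : V → ℝ) (u : V → ℝ) (x : V) : ℝ :=
  (S.lap u x) ^ 2 + a * S.gradSq u x + Vp x * (u x) ^ 2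

/-- Membership in the working space `E_i` (finiteness of the `E_i`-norm). -/
def memE (a : ℝ) (Vp : V → ℝ) (u : V → ℝ) : Prop :=
  Summable fun x => S.energyDensity a Vp u x * S.mu x

/-- The norm `‖u‖_{E_i} = (∫_V (|Δu|² + a_i |∇u|² + V_i(x)u²) dμ)^{1/2}`. -/
noncomputable def normE (a : ℝ) (Vp : V → ℝ) (u : V → ℝ) : ℝ :=
  Real.sqrt (S.integral (S.energyDensity a Vp u))

/-- The inner product `(u,v)_{E_i} = ∫_V (Δu Δv + a_i ∇u·∇v + V_i(x) u v) dμ`. -/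
noncomputable def innerE (a : ℝ) (Vp : V → ℝ) (u v : V → ℝ) : ℝ :=
  S.integral fun x => S.lap u x * S.lap v x + a * S.gradDot u v x + Vp x * u x * v x

/-- The energy functional `Φ` of the biharmonic–Kirchhoff system. -/
noncomputable def Phi (a₁ a₂ b₁ b₂ : ℝ) (V₁ V₂ : V → ℝ) (F : V → ℝ → ℝ → ℝ)
    (u v : V → ℝ) : ℝ :=
  (1/2) * S.integral (S.energyDensity a₁ V₁ u) + (1/2) * S.integral (S.energyDensity a₂ V₂ v)
    + (b₁/4) * (S.integral (S.gradSq u)) ^ 2 + (b₂/4) * (S.integral (S.gradSq v)) ^ 2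
    - S.integral fun x => F x (u x) (v x)

/-- The action `⟨Φ'(u,v), (φ₁,φ₂)⟩` of the derivative of `Φ`. -/
noncomputable def PhiDeriv (a₁ a₂ b₁ b₂ : ℝ) (V₁ V₂ : V → ℝ) (Fs Ft : V → ℝ → ℝ → ℝ)
    (u v φ₁ φ₂ : V → ℝ) : ℝ :=
  S.innerE a₁ V₁ u φ₁ + S.innerE a₂ V₂ v φ₂
    + b₁ * S.integral (S.gradSq u) * S.integral (S.gradDot u φ₁)
    + b₂ * S.integral (S.gradSq v) * S.integral (S.gradDot v φ₂)
    - S.integral (fun x => Fs x (u x) (v x) * φ₁ x)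
    - S.integral (fun x => Ft x (u x) (v x) * φ₂ x)

/-- `(u,v)` solves the biharmonic–Kirchhoff system (pointwise on `V`). -/
def IsSolution (a₁ a₂ b₁ b₂ : ℝ) (V₁ V₂ : V → ℝ) (Fs Ft : V → ℝ → ℝ → ℝ)
    (u v : V → ℝ) : Prop :=
  (∀ x, S.lap (S.lap u) x - (a₁ + b₁ * S.integral (S.gradSq u)) * S.lap u x + V₁ x * u x
      = Fs x (u x) (v x)) ∧
  (∀ x, S.lap (S.lap v) x - (a₂ + b₂ * S.integral (S.gradSq v)) * S.lap v x + V₂ x * v x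
      = Ft x (u x) (v x))

/-- Condition (V): `θᵢ = inf_V Vᵢ > 0` and `Vᵢ(x) → +∞` as `d(x,x₀) → ∞`. -/
def CondV (V₁ V₂ : V → ℝ) (θ₁ θ₂ : ℝ) : Prop :=
  IsGLB (Set.range V₁) θ₁ ∧ IsGLB (Set.range V₂) θ₂ ∧ 0 < θ₁ ∧ 0 < θ₂ ∧
    ∃ x₀ : V, ∀ M : ℝ, ∃ N : ℕ, ∀ x : V, N ≤ S.G.dist x₀ x → M ≤ V₁ x ∧ M ≤ V₂ x

/-- Condition (F₀). -/
def CondF0 (F : V → ℝ → ℝ → ℝ) : Prop :=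
  (∀ x, F x 0 0 = 0) ∧ ∀ x, ContDiff ℝ 1 (fun p : ℝ × ℝ => F x p.1 p.2)

/-- `Fs` and `Ft` are the partial derivatives of `F` in its last two arguments. -/
def IsPartialDerivs (F Fs Ft : V → ℝ → ℝ → ℝ) : Prop :=
  ∀ x s t, HasDerivAt (fun s' => F x s' t) (Fs x s t) s ∧
           HasDerivAt (fun t' => F x s t') (Ft x s t) t

/-- Condition (F₁). -/
def CondF1 (F Fs Ft : V → ℝ → ℝ → ℝ) (a : ℝ → ℝ) (b : V → ℝ) : Prop :=
  ContinuousOn a (Set.Ici 0) ∧ (∀ r : ℝ, 0 ≤ r → 0 ≤ a r) ∧ (∀ x, 0 < b x) ∧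
    Summable (fun x => b x * S.mu x) ∧
    ∀ x s t, |Fs x s t| ≤ a (Real.sqrt (s ^ 2 + t ^ 2)) * b x ∧
             |Ft x s t| ≤ a (Real.sqrt (s ^ 2 + t ^ 2)) * b x ∧
             |F x s t| ≤ a (Real.sqrt (s ^ 2 + t ^ 2)) * b x

/-- Condition (C₁): `lim_{r → 0⁺} a(r)/r² = h < ∞`. -/
def CondC1 (a : ℝ → ℝ) : Prop :=
  ∃ h : ℝ, Tendsto (fun r => a r / r ^ 2) (nhdsWithin 0 (Set.Ioi 0)) (nhds h)

/-- `γ_{∞,i} = (μ_min · inf_V V_i)^{-1/2}`. -/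
noncomputable def gammaInf (θ : ℝ) : ℝ := 1 / Real.sqrt (S.mumin * θ)

/-- Condition (C₂). -/
def CondC2 (a : ℝ → ℝ) (b : V → ℝ) (θ₁ θ₂ : ℝ) : Prop :=
  ∃ ρ : ℝ, 0 < ρ ∧
    0 < ρ ^ 2 / 4 - sSup (a '' Set.Icc 0 ((S.gammaInf θ₁ + S.gammaInf θ₂) * ρ)) * S.integral b

/-- Condition (F₂): `F(x,s,t)/|(s,t)|⁴ → +∞` as `|(s,t)| → ∞`, uniformly in `x`. -/
def CondF2 (F : V → ℝ → ℝ → ℝ) : Prop :=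
  ∀ M : ℝ, ∃ R : ℝ, ∀ x s t, R ≤ Real.sqrt (s ^ 2 + t ^ 2) → M * (s ^ 2 + t ^ 2) ^ 2 ≤ F x s t

/-- Condition (F₂)': `F(x,s,t)/|(s,t)|² → +∞` as `|(s,t)| → ∞`, uniformly in `x`. -/
def CondF2' (F : V → ℝ → ℝ → ℝ) : Prop :=
  ∀ M : ℝ, ∃ R : ℝ, ∀ x s t, R ≤ Real.sqrt (s ^ 2 + t ^ 2) → M * (s ^ 2 + t ^ 2) ≤ F x s t

/-- Condition (F₃): `F ≥ 0` outside the ball of radius `r₀`. -/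
def CondF3 (F : V → ℝ → ℝ → ℝ) (r₀ : ℝ) : Prop :=
  ∀ x s t, r₀ ≤ Real.sqrt (s ^ 2 + t ^ 2) → 0 ≤ F x s t

/-- `𝓕(x,s,t) = λ (s F_s + t F_t) - F` (with `λ = 1/4` resp. `1/2`). -/
noncomputable def curlyF (lam : ℝ) (F Fs Ft : V → ℝ → ℝ → ℝ) (x : V) (s t : ℝ) : ℝ :=
  lam * (s * Fs x s t + t * Ft x s t) - F x s t

/-- Condition (F₄) (with `λ = 1/4`); `k` is a real exponent and `^` is `Real.rpow`. -/
def CondF4 (F Fs Ft : V → ℝ → ℝ → ℝ) (r₀ : ℝ) : Prop :=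
  (∀ (x : V) (s t : ℝ), 0 ≤ curlyF (1/4) F Fs Ft x s t) ∧
  ∃ c : ℝ, 0 < c ∧ ∃ k : ℝ, 1 < k ∧ ∀ (x : V) (s t : ℝ), r₀ ≤ Real.sqrt (s ^ 2 + t ^ 2) →
    |F x s t| ^ k ≤ c * (s ^ 2 + t ^ 2) ^ k * curlyF (1/4) F Fs Ft x s t

/-- Condition (F₄)' (with `λ = 1/2`). -/
def CondF4' (F Fs Ft : V → ℝ → ℝ → ℝ) (r₀ : ℝ) : Prop :=
  (∀ (x : V) (s t : ℝ), 0 ≤ curlyF (1/2) F Fs Ft x s t) ∧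
  ∃ c : ℝ, 0 < c ∧ ∃ k : ℝ, 1 < k ∧ ∀ (x : V) (s t : ℝ), r₀ ≤ Real.sqrt (s ^ 2 + t ^ 2) →
    |F x s t| ^ k ≤ c * (s ^ 2 + t ^ 2) ^ k * curlyF (1/2) F Fs Ft x s t

/-- `γ_{2,i} = (inf_V V_i)^{-1/2}`. -/
noncomputable def gamma2 (θ : ℝ) : ℝ := 1 / Real.sqrt θ

/-- Condition (F₅) (`lb = 4`), resp. (F₅)' (`lb = 2`): there are `μ̄ > lb` and an admissible
`σ` with `μ̄ F ≤ s F_s + t F_t + σ (s² + t²)`. -/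
def CondF5 (lb : ℝ) (F Fs Ft : V → ℝ → ℝ → ℝ) (θ₁ θ₂ : ℝ) : Prop :=
  ∃ μb : ℝ, lb < μb ∧ ∃ σ : ℝ, 0 < σ ∧
    σ < (μb - 2) / (2 * max (gamma2 θ₁ ^ 2) (gamma2 θ₂ ^ 2)) ∧
    ∀ (x : V) (s t : ℝ), μb * F x s t ≤ s * Fs x s t + t * Ft x s t + σ * (s ^ 2 + t ^ 2)

/-- Condition (F₆): `F` is even in `(s,t)`. -/
def CondF6 (F : V → ℝ → ℝ → ℝ) : Prop :=
  ∀ (x : V) (s t : ℝ), F x (-s) (-t) = F x s t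

/-- A Cerami sequence for `Φ`: `Φ(uₙ,vₙ)` is bounded and
`(1 + ‖(uₙ,vₙ)‖)‖Φ'(uₙ,vₙ)‖_{E*} → 0`. -/
def CeramiSeq (a₁ a₂ b₁ b₂ : ℝ) (V₁ V₂ : V → ℝ) (F Fs Ft : V → ℝ → ℝ → ℝ)
    (u v : ℕ → V → ℝ) : Prop :=
  (∀ n, S.memE a₁ V₁ (u n) ∧ S.memE a₂ V₂ (v n)) ∧
  (∃ C : ℝ, ∀ n, |S.Phi a₁ a₂ b₁ b₂ V₁ V₂ F (u n) (v n)| ≤ C) ∧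
  ∃ ε : ℕ → ℝ, Tendsto ε atTop (nhds 0) ∧
    ∀ (n : ℕ) (φ₁ φ₂ : V → ℝ), S.memE a₁ V₁ φ₁ → S.memE a₂ V₂ φ₂ →
      S.normE a₁ V₁ φ₁ + S.normE a₂ V₂ φ₂ ≤ 1 →
      (1 + (S.normE a₁ V₁ (u n) + S.normE a₂ V₂ (v n))) *
        |S.PhiDeriv a₁ a₂ b₁ b₂ V₁ V₂ Fs Ft (u n) (v n) φ₁ φ₂| ≤ ε n

end WeightedGraph

open WeightedGraph

namespace WeightedGraph

section PosForms

variable {ι E : Type*} [AddCommGroup E] [Module ℝ E] {B : ι → LinearMap.BilinForm ℝ E}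

theorem form_sub_self (hsymm : ∀ i u v, B i u v = B i v u) (i : ι) (u v : E) :
    B i (u - v) (u - v) = B i u u + B i v v - 2 * B i u v := by
  simp only [map_sub, LinearMap.sub_apply, hsymm i v u]
  ring

theorem two_mul_abs_form_le (hsymm : ∀ i u v, B i u v = B i v u) (hpos : ∀ i u, 0 ≤ B i u u)
    (i : ι) (u v : E) : 2 * |B i u v| ≤ B i u u + B i v v := by
  have h₁ := hpos i (u - v)
  have h₂ := hpos i (u + v)
  rw [form_sub_self hsymm] at h₁
  simp only [map_add, LinearMap.add_apply, hsymm i v u] at h₂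
  rcases abs_cases (B i u v) with h | h <;> linarith

theorem summable_form (hsymm : ∀ i u v, B i u v = B i v u) (hpos : ∀ i u, 0 ≤ B i u u)
    {u v : E} (hu : Summable fun i => B i u u) (hv : Summable fun i => B i v v) :
    Summable fun i => B i u v := by
  refine Summable.of_norm_bounded (hu.add hv) fun i => ?_
  have := two_mul_abs_form_le hsymm hpos i u v
  rw [Real.norm_eq_abs]
  linarith [abs_nonneg (B i u v)]

theorem summable_form_sub_self (hsymm : ∀ i u v, B i u v = B i v u) (hpos : ∀ i u, 0 ≤ B i u u)
    {u v : E} (hu : Summable fun i => B i u u) (hv : Summable fun i => B i v v) :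
    Summable fun i => B i (u - v) (u - v) := by
  simp only [form_sub_self hsymm]
  exact (hu.add hv).sub ((summable_form hsymm hpos hu hv).mul_left 2)

theorem tsum_form_sub_right (hsymm : ∀ i u v, B i u v = B i v u) (hpos : ∀ i u, 0 ≤ B i u u)
    {u v w : E} (hu : Summable fun i => B i u u) (hv : Summable fun i => B i v v)
    (hw : Summable fun i => B i w w) :
    ∑' i, B i w (u - v) = ∑' i, B i w u - ∑' i, B i w v := by
  simp only [map_sub]
  exact (summable_form hsymm hpos hw hu).tsum_sub (summable_form hsymm hpos hw hv)

theorem tsum_form_comm (hsymm : ∀ i u v, B i u v = B i v u) (u v : E) :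
    ∑' i, B i u v = ∑' i, B i v u :=
  tsum_congr fun i => hsymm i u v

theorem tsum_form_sub_self (hsymm : ∀ i u v, B i u v = B i v u) (hpos : ∀ i u, 0 ≤ B i u u)
    {u v : E} (hu : Summable fun i => B i u u) (hv : Summable fun i => B i v v) :
    ∑' i, B i (u - v) (u - v) = ∑' i, B i u u + ∑' i, B i v v - 2 * ∑' i, B i u v := by
  simp only [form_sub_self hsymm]
  rw [(hu.add hv).tsum_sub ((summable_form hsymm hpos hu hv).mul_left 2), hu.tsum_add hv,
    tsum_mul_left]

theorem two_mul_tsum_form_le (hsymm : ∀ i u v, B i u v = B i v u) (hpos : ∀ i u, 0 ≤ B i u u)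
    {u v : E} (hu : Summable fun i => B i u u) (hv : Summable fun i => B i v v) :
    2 * ∑' i, B i u v ≤ ∑' i, B i u u + ∑' i, B i v v := by
  have h : 0 ≤ ∑' i, B i (u - v) (u - v) := tsum_nonneg fun i => hpos i _
  rw [tsum_form_sub_self hsymm hpos hu hv] at h
  linarith

theorem tsum_form_sub_self_le (hsymm : ∀ i u v, B i u v = B i v u) (hpos : ∀ i u, 0 ≤ B i u u)
    {u v : E} (hu : Summable fun i => B i u u) (hv : Summable fun i => B i v v) :
    ∑' i, B i (u - v) (u - v) ≤ 2 * ∑' i, B i u u + 2 * ∑' i, B i v v := by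
  have h : -(∑' i, B i u u + ∑' i, B i v v) ≤ 2 * ∑' i, B i u v := by
    rw [← hu.tsum_add hv, ← tsum_neg, ← tsum_mul_left]
    refine (hu.add hv).neg.tsum_le_tsum (fun i => ?_)
      ((summable_form hsymm hpos hu hv).mul_left 2)
    have := two_mul_abs_form_le hsymm hpos i u v
    have := neg_abs_le (B i u v)
    linarith
  rw [tsum_form_sub_self hsymm hpos hu hv]
  linarith

/-- The derivative of the convex functional `u ↦ ¼ (∑ᵢ Bᵢ(u, u))²` is monotone. -/
theorem kirchhoff_monotone (hsymm : ∀ i u v, B i u v = B i v u) (hpos : ∀ i u, 0 ≤ B i u u)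
    {u v : E} (hu : Summable fun i => B i u u) (hv : Summable fun i => B i v v) :
    0 ≤ (∑' i, B i u u) * ∑' i, B i u (u - v) - (∑' i, B i v v) * ∑' i, B i v (u - v) := by
  have h := two_mul_tsum_form_le hsymm hpos hu hv
  have hu0 : 0 ≤ ∑' i, B i u u := tsum_nonneg fun i => hpos i u
  have hv0 : 0 ≤ ∑' i, B i v v := tsum_nonneg fun i => hpos i v
  rw [tsum_form_sub_right hsymm hpos hu hv hu, tsum_form_sub_right hsymm hpos hu hv hv,
    tsum_form_comm hsymm v u]
  nlinarith [sq_nonneg (∑' i, B i u u - ∑' i, B i v v),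
    mul_le_mul_of_nonneg_left h (add_nonneg hu0 hv0)]

end PosForms

section Forms

variable {V : Type*} (S : WeightedGraph V)

theorem mu_pos (x : V) : 0 < S.mu x := S.mumin_pos.trans_le (S.mu_ge x)

theorem w_nonneg (x y : V) : 0 ≤ S.w x y := by
  by_cases h : S.G.Adj x y
  · exact (S.w_pos x y h).le
  · exact (S.w_eq_zero x y h).ge

theorem w_eq_zero_of_notMem {x y : V} (hy : y ∉ (S.locallyFinite x).toFinset) :
    S.w x y = 0 :=
  S.w_eq_zero x y fun h => hy (by simpa using h)

theorem lap_eq_sum (u : V → ℝ) (x : V) :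
    S.lap u x =
      1 / S.mu x * ∑ y ∈ (S.locallyFinite x).toFinset, S.w x y * (u y - u x) := by
  rw [lap, tsum_eq_sum fun y hy => by rw [S.w_eq_zero_of_notMem hy, zero_mul]]

theorem gradDot_eq_sum (u v : V → ℝ) (x : V) :
    S.gradDot u v x = 1 / (2 * S.mu x) *
      ∑ y ∈ (S.locallyFinite x).toFinset, S.w x y * (u y - u x) * (v y - v x) := by
  rw [gradDot, tsum_eq_sum fun y hy => by rw [S.w_eq_zero_of_notMem hy, zero_mul, zero_mul]]

theorem gradDot_self (u : V → ℝ) (x : V) : S.gradDot u u x = S.gradSq u x := by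
  simp only [gradDot, gradSq, pow_two, mul_assoc]

theorem gradSq_nonneg (u : V → ℝ) (x : V) : 0 ≤ S.gradSq u x :=
  mul_nonneg (one_div_nonneg.2 (mul_pos two_pos (S.mu_pos x)).le)
    (tsum_nonneg fun y => mul_nonneg (S.w_nonneg x y) (sq_nonneg _))

theorem gradDot_comm (u v : V → ℝ) (x : V) : S.gradDot u v x = S.gradDot v u x := by
  simp only [gradDot, mul_right_comm]

theorem lap_add (u v : V → ℝ) (x : V) : S.lap (u + v) x = S.lap u x + S.lap v x := by
  simp only [lap_eq_sum, Pi.add_apply, ← mul_add, ← Finset.sum_add_distrib]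
  congr 1
  exact Finset.sum_congr rfl fun y _ => by ring

theorem lap_smul (c : ℝ) (u : V → ℝ) (x : V) : S.lap (c • u) x = c * S.lap u x := by
  simp only [lap_eq_sum, Pi.smul_apply, smul_eq_mul]
  rw [mul_left_comm]
  congr 1
  rw [Finset.mul_sum]
  exact Finset.sum_congr rfl fun y _ => by ring

theorem gradDot_add_left (u u' v : V → ℝ) (x : V) :
    S.gradDot (u + u') v x = S.gradDot u v x + S.gradDot u' v x := by
  simp only [gradDot_eq_sum, Pi.add_apply, ← mul_add, ← Finset.sum_add_distrib]
  congr 1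
  exact Finset.sum_congr rfl fun y _ => by ring

theorem gradDot_smul_left (c : ℝ) (u v : V → ℝ) (x : V) :
    S.gradDot (c • u) v x = c * S.gradDot u v x := by
  simp only [gradDot_eq_sum, Pi.smul_apply, smul_eq_mul]
  rw [mul_left_comm]
  congr 1
  rw [Finset.mul_sum]
  exact Finset.sum_congr rfl fun y _ => by ring

theorem gradDot_add_right (u v v' : V → ℝ) (x : V) :
    S.gradDot u (v + v') x = S.gradDot u v x + S.gradDot u v' x := by
  rw [gradDot_comm, gradDot_add_left, gradDot_comm, S.gradDot_comm v']

theorem gradDot_smul_right (c : ℝ) (u v : V → ℝ) (x : V) :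
    S.gradDot u (c • v) x = c * S.gradDot u v x := by
  rw [gradDot_comm, gradDot_smul_left, gradDot_comm]

/-- The bilinear form `(u, v) ↦ ∇u·∇v(x) μ(x)`. -/
noncomputable def gradForm (x : V) : LinearMap.BilinForm ℝ (V → ℝ) :=
  LinearMap.mk₂ ℝ (fun u v => S.gradDot u v x * S.mu x)
    (fun u u' v => by simp only [gradDot_add_left]; ring)
    (fun c u v => by simp only [gradDot_smul_left, smul_eq_mul]; ring)
    (fun u v v' => by simp only [gradDot_add_right]; ring)
    (fun c u v => by simp only [gradDot_smul_right, smul_eq_mul]; ring)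

/-- The bilinear form `(u, v) ↦ (Δu Δv + a ∇u·∇v + V u v)(x) μ(x)`. -/
noncomputable def energyForm (a : ℝ) (Vp : V → ℝ) (x : V) : LinearMap.BilinForm ℝ (V → ℝ) :=
  LinearMap.mk₂ ℝ
    (fun u v => (S.lap u x * S.lap v x + a * S.gradDot u v x + Vp x * u x * v x) * S.mu x)
    (fun u u' v => by simp only [gradDot_add_left, lap_add, Pi.add_apply]; ring)
    (fun c u v => by
      simp only [gradDot_smul_left, lap_smul, Pi.smul_apply, smul_eq_mul]; ring)
    (fun u v v' => by simp only [gradDot_add_right, lap_add, Pi.add_apply]; ring)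
    (fun c u v => by
      simp only [gradDot_smul_right, lap_smul, Pi.smul_apply, smul_eq_mul]; ring)

theorem gradForm_symm (x : V) (u v : V → ℝ) : S.gradForm x u v = S.gradForm x v u := by
  simp only [gradForm, LinearMap.mk₂_apply, S.gradDot_comm u v]

theorem gradForm_self (x : V) (u : V → ℝ) : S.gradForm x u u = S.gradSq u x * S.mu x := by
  simp only [gradForm, LinearMap.mk₂_apply, gradDot_self]

theorem gradForm_self_nonneg (x : V) (u : V → ℝ) : 0 ≤ S.gradForm x u u := by
  rw [gradForm_self]
  exact mul_nonneg (S.gradSq_nonneg u x) (S.mu_pos x).le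

variable {a : ℝ} {Vp : V → ℝ}

theorem energyForm_symm (x : V) (u v : V → ℝ) :
    S.energyForm a Vp x u v = S.energyForm a Vp x v u := by
  simp only [energyForm, LinearMap.mk₂_apply, S.gradDot_comm u v]
  ring

theorem energyForm_self (x : V) (u : V → ℝ) :
    S.energyForm a Vp x u u = S.energyDensity a Vp u x * S.mu x := by
  simp only [energyForm, LinearMap.mk₂_apply, gradDot_self, energyDensity]
  ring

theorem energyForm_self_nonneg (ha : 0 ≤ a) (hVp : ∀ x, 0 ≤ Vp x) (x : V) (u : V → ℝ) :
    0 ≤ S.energyForm a Vp x u u := by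
  rw [energyForm_self]
  exact mul_nonneg (add_nonneg (add_nonneg (sq_nonneg _) (mul_nonneg ha (S.gradSq_nonneg u x)))
    (mul_nonneg (hVp x) (sq_nonneg _))) (S.mu_pos x).le

theorem continuous_energyForm_self (x : V) :
    Continuous fun u : V → ℝ => S.energyForm a Vp x u u := by
  simp only [energyForm, LinearMap.mk₂_apply, lap_eq_sum, gradDot_eq_sum]
  fun_prop

theorem memE_iff (u : V → ℝ) :
    S.memE a Vp u ↔ Summable fun x => S.energyForm a Vp x u u := by
  simp only [memE, energyForm_self]

theorem integral_energyDensity (u : V → ℝ) :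
    S.integral (S.energyDensity a Vp u) = ∑' x, S.energyForm a Vp x u u := by
  simp only [integral, energyForm_self]

theorem innerE_eq_tsum (u v : V → ℝ) :
    S.innerE a Vp u v = ∑' x, S.energyForm a Vp x u v := by
  simp only [innerE, integral, energyForm, LinearMap.mk₂_apply]

theorem integral_gradDot (u v : V → ℝ) :
    S.integral (S.gradDot u v) = ∑' x, S.gradForm x u v := by
  simp only [integral, gradForm, LinearMap.mk₂_apply]

theorem integral_gradSq (u : V → ℝ) :
    S.integral (S.gradSq u) = ∑' x, S.gradForm x u u := by
  simp only [integral, gradForm_self]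

theorem innerE_self (u : V → ℝ) :
    S.innerE a Vp u u = S.integral (S.energyDensity a Vp u) := by
  rw [innerE_eq_tsum, integral_energyDensity]

theorem integral_gradDot_self (u : V → ℝ) :
    S.integral (S.gradDot u u) = S.integral (S.gradSq u) := by
  rw [integral_gradDot, integral_gradSq]

theorem summable_gradForm_self (ha : 0 < a) (hVp : ∀ x, 0 ≤ Vp x) {u : V → ℝ}
    (hu : S.memE a Vp u) : Summable fun x => S.gradForm x u u := by
  refine Summable.of_nonneg_of_le (fun x => S.gradForm_self_nonneg x u) (fun x => ?_)
    (hu.mul_left a⁻¹)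
  rw [gradForm_self, ← mul_assoc]
  refine mul_le_mul_of_nonneg_right ?_ (S.mu_pos x).le
  rw [inv_mul_eq_div, le_div_iff₀ ha, energyDensity]
  nlinarith [sq_nonneg (S.lap u x), mul_nonneg (hVp x) (sq_nonneg (u x))]

theorem integral_energyDensity_nonneg (ha : 0 ≤ a) (hVp : ∀ x, 0 ≤ Vp x) (u : V → ℝ) :
    0 ≤ S.integral (S.energyDensity a Vp u) := by
  rw [integral_energyDensity]
  exact tsum_nonneg fun x => S.energyForm_self_nonneg ha hVp x u

theorem memE_smul (c : ℝ) {u : V → ℝ} (hu : S.memE a Vp u) : S.memE a Vp (c • u) := by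
  rw [memE_iff] at hu ⊢
  simp only [map_smul, LinearMap.smul_apply, smul_eq_mul]
  exact (hu.mul_left c).mul_left c

theorem memE_zero : S.memE a Vp 0 := by
  rw [memE_iff]
  simp only [map_zero]
  exact summable_zero

theorem normE_zero : S.normE a Vp 0 = 0 := by
  simp [normE, integral_energyDensity]

theorem normE_smul (c : ℝ) (u : V → ℝ) : S.normE a Vp (c • u) = |c| * S.normE a Vp u := by
  rw [normE, normE, integral_energyDensity, integral_energyDensity]
  simp only [map_smul, LinearMap.smul_apply, smul_eq_mul, tsum_mul_left]
  rw [← mul_assoc, Real.sqrt_mul (mul_self_nonneg c), Real.sqrt_mul_self_eq_abs]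

/-- Finite energy controls the supremum norm. -/
theorem sq_apply_le {θ : ℝ} (ha : 0 ≤ a) (hθ : 0 < θ) (hVp : ∀ x, θ ≤ Vp x) {u : V → ℝ}
    (hu : S.memE a Vp u) (x : V) :
    u x ^ 2 ≤ S.integral (S.energyDensity a Vp u) / (θ * S.mumin) := by
  have hVp0 : ∀ x, 0 ≤ Vp x := fun x => hθ.le.trans (hVp x)
  rw [le_div_iff₀ (mul_pos hθ S.mumin_pos)]
  have h₁ : S.energyDensity a Vp u x * S.mu x ≤ S.integral (S.energyDensity a Vp u) :=
    hu.le_tsum x fun y _ => by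
      rw [← energyForm_self]; exact S.energyForm_self_nonneg ha hVp0 y u
  refine le_trans ?_ h₁
  have h₂ : θ * u x ^ 2 ≤ S.energyDensity a Vp u x := by
    rw [energyDensity]
    nlinarith [sq_nonneg (S.lap u x), mul_nonneg ha (S.gradSq_nonneg u x),
      mul_le_mul_of_nonneg_right (hVp x) (sq_nonneg (u x))]
  calc u x ^ 2 * (θ * S.mumin) = θ * u x ^ 2 * S.mumin := by ring
    _ ≤ S.energyDensity a Vp u x * S.mu x :=
      mul_le_mul h₂ (S.mu_ge x) S.mumin_pos.le ((mul_nonneg hθ.le (sq_nonneg _)).trans h₂)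

end Forms

section Convergence

variable {V : Type*} (S : WeightedGraph V) {a : ℝ} {Vp : V → ℝ}

/-- A sequence whose mutual energy distances are at most `ηₙ + ηₘ` with `η → 0` and which
converges pointwise converges in the energy norm. -/
theorem tendsto_normE_of_tendsto_pointwise (ha : 0 ≤ a) (hVp : ∀ x, 0 ≤ Vp x)
    {u : ℕ → V → ℝ} {w : V → ℝ} {η : ℕ → ℝ} (hu : ∀ n, S.memE a Vp (u n))
    (hη : Tendsto η atTop (𝓝 0)) (hw : ∀ x, Tendsto (fun n => u n x) atTop (𝓝 (w x)))
    (hdist : ∀ n m, S.integral (S.energyDensity a Vp (u n - u m)) ≤ η n + η m) :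
    S.memE a Vp w ∧ Tendsto (fun n => S.normE a Vp (u n - w)) atTop (𝓝 0) := by
  have hpos := S.energyForm_self_nonneg ha hVp
  have hfin : ∀ n (s : Finset V), ∑ x ∈ s, S.energyForm a Vp x (u n - w) (u n - w) ≤ η n := by
    intro n s
    have hlim : Tendsto
        (fun m => ∑ x ∈ s, S.energyForm a Vp x (u n - u m) (u n - u m)) atTop
        (𝓝 (∑ x ∈ s, S.energyForm a Vp x (u n - w) (u n - w))) :=
      tendsto_finsetSum _ fun x _ =>
        ((S.continuous_energyForm_self x).tendsto _).comp
          (tendsto_const_nhds.sub (tendsto_pi_nhds.2 hw))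
    have hlim' : Tendsto (fun m => η n + η m) atTop (𝓝 (η n)) := by
      simpa using tendsto_const_nhds.add hη
    refine le_of_tendsto_of_tendsto' hlim hlim' fun m => le_trans ?_ (hdist n m)
    rw [integral_energyDensity]
    exact (summable_form_sub_self S.energyForm_symm hpos ((S.memE_iff _).1 (hu n))
      ((S.memE_iff _).1 (hu m))).sum_le_tsum s fun x _ => hpos x _
  have hsum : ∀ n, Summable fun x => S.energyForm a Vp x (u n - w) (u n - w) := fun n =>
    summable_of_sum_le (fun x => hpos x _) (hfin n)
  constructor
  · rw [memE_iff]
    simpa using summable_form_sub_self S.energyForm_symm hpos ((S.memE_iff _).1 (hu 0)) (hsum 0)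
  · have hsq : Tendsto (fun n => S.integral (S.energyDensity a Vp (u n - w))) atTop (𝓝 0) := by
      refine squeeze_zero (fun n => S.integral_energyDensity_nonneg ha hVp _) (fun n => ?_) hη
      rw [integral_energyDensity]
      exact (hsum n).tsum_le_of_sum_le (hfin n)
    simpa [normE] using hsq.sqrt

theorem abs_integral_mul_le {b f g h : V → ℝ} {A : ℝ}
    (hsum : Summable fun x => b x * |h x| * S.mu x)
    (hf : ∀ x, |f x| ≤ A * b x) (hg : ∀ x, |g x| ≤ |h x|) :
    |S.integral fun x => f x * g x| ≤ A * ∑' x, b x * |h x| * S.mu x := by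
  rw [integral, ← Real.norm_eq_abs, ← tsum_mul_left]
  refine tsum_of_norm_bounded (hsum.mul_left A).hasSum fun x => ?_
  rw [Real.norm_eq_abs, abs_mul, abs_mul, abs_of_pos (S.mu_pos x)]
  calc |f x| * |g x| * S.mu x ≤ A * b x * |h x| * S.mu x :=
        mul_le_mul_of_nonneg_right
          (mul_le_mul (hf x) (hg x) (abs_nonneg _) ((abs_nonneg _).trans (hf x))) (S.mu_pos x).le
    _ = A * (b x * |h x| * S.mu x) := by ring

theorem summable_mul_of_bounded {b f g : V → ℝ} {A R : ℝ} (hb : Summable fun x => b x * S.mu x)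
    (hf : ∀ x, |f x| ≤ A * b x) (hg : ∀ x, |g x| ≤ R) :
    Summable fun x => f x * g x * S.mu x := by
  refine Summable.of_norm_bounded (hb.mul_left (A * R)) fun x => ?_
  rw [Real.norm_eq_abs, abs_mul, abs_mul, abs_of_pos (S.mu_pos x)]
  calc |f x| * |g x| * S.mu x ≤ A * b x * R * S.mu x :=
        mul_le_mul_of_nonneg_right
          (mul_le_mul (hf x) (hg x) (abs_nonneg _) ((abs_nonneg _).trans (hf x))) (S.mu_pos x).le
    _ = A * R * (b x * S.mu x) := by ring

/-- The Palais–Smale condition for a single component: the nonlinearity is dominated by a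
summable weight and the sequence converges pointwise and is bounded. -/
theorem tendsto_normE_of_almost_critical {κ A M R : ℝ} (ha : 0 < a) (hκ : 0 ≤ κ)
    (hVp : ∀ x, 0 ≤ Vp x) {b : V → ℝ} (hb0 : ∀ x, 0 ≤ b x)
    (hb : Summable fun x => b x * S.mu x)
    {u f : ℕ → V → ℝ} {w : V → ℝ} {ε : ℕ → ℝ} (hu : ∀ n, S.memE a Vp (u n))
    (hM : ∀ n, S.integral (S.energyDensity a Vp (u n)) ≤ M)
    (hR : ∀ n x, |u n x| ≤ R) (hf : ∀ n x, |f n x| ≤ A * b x)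
    (hε : Tendsto ε atTop (𝓝 0)) (hw : ∀ x, Tendsto (fun n => u n x) atTop (𝓝 (w x)))
    (hcrit : ∀ n φ, S.memE a Vp φ →
      |S.innerE a Vp (u n) φ + κ * S.integral (S.gradSq (u n)) * S.integral (S.gradDot (u n) φ)
        - S.integral fun x => f n x * φ x| ≤ ε n * (1 + S.normE a Vp φ)) :
    S.memE a Vp w ∧ Tendsto (fun n => S.normE a Vp (u n - w)) atTop (𝓝 0) := by
  have hpos := S.energyForm_self_nonneg ha.le hVp
  have hwR : ∀ x, |w x| ≤ R := fun x => le_of_tendsto (hw x).abs (.of_forall fun n => hR n x)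
  have hbd : ∀ n x, |u n x - w x| ≤ 2 * R := fun n x =>
    (abs_sub _ _).trans (by linarith [hR n x, hwR x])
  have hβsum : ∀ n, Summable fun x => b x * |u n x - w x| * S.mu x := fun n =>
    S.summable_mul_of_bounded (A := 1) (R := 2 * R) hb
      (fun x => by rw [abs_of_nonneg (hb0 x), one_mul])
      (fun x => by rw [abs_abs]; exact hbd n x)
  set β : ℕ → ℝ := fun n => ∑' x, b x * |u n x - w x| * S.mu x with hβ_def
  have hβ : Tendsto β atTop (𝓝 0) := by
    have h := tendsto_tsum_of_dominated_convergence (𝓕 := atTop)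
      (f := fun n x => b x * |u n x - w x| * S.mu x) (g := fun _ => (0 : ℝ))
      (bound := fun x => 2 * R * (b x * S.mu x)) (hb.mul_left _) (fun x => ?_)
      (.of_forall fun n x => ?_)
    · simpa using h
    · have := (((hw x).sub_const (w x)).abs.const_mul (b x)).mul_const (S.mu x)
      simpa using this
    · rw [Real.norm_eq_abs, abs_of_nonneg
        (mul_nonneg (mul_nonneg (hb0 x) (abs_nonneg _)) (S.mu_pos x).le)]
      calc b x * |u n x - w x| * S.mu x ≤ b x * (2 * R) * S.mu x :=
            mul_le_mul_of_nonneg_right (mul_le_mul_of_nonneg_left (hbd n x) (hb0 x))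
              (S.mu_pos x).le
        _ = 2 * R * (b x * S.mu x) := by ring
  have hε0 : ∀ n, 0 ≤ ε n := fun n => by
    have := hcrit n 0 S.memE_zero
    rw [normE_zero] at this
    linarith [(abs_nonneg _).trans this]
  set K : ℝ := 1 + √(4 * M)
  refine S.tendsto_normE_of_tendsto_pointwise ha.le hVp hu
    (η := fun n => ε n * K + 2 * A * β n) ?_ hw fun n m => ?_
  · simpa using (hε.mul_const K).add (hβ.const_mul (2 * A))
  have hun := (S.memE_iff _).1 (hu n)
  have hum := (S.memE_iff _).1 (hu m)
  have hφ : S.memE a Vp (u n - u m) :=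
    (S.memE_iff _).2 (summable_form_sub_self S.energyForm_symm hpos hun hum)
  have hnorm : 1 + S.normE a Vp (u n - u m) ≤ K := by
    refine add_le_add_right (Real.sqrt_le_sqrt ?_) 1
    have h := tsum_form_sub_self_le S.energyForm_symm hpos hun hum
    simp only [← integral_energyDensity] at h
    linarith [hM n, hM m]
  have hQ : S.integral (S.energyDensity a Vp (u n - u m)) =
      S.innerE a Vp (u n) (u n - u m) - S.innerE a Vp (u m) (u n - u m) := by
    rw [integral_energyDensity, innerE_eq_tsum, innerE_eq_tsum,
      tsum_form_sub_self S.energyForm_symm hpos hun hum,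
      tsum_form_sub_right S.energyForm_symm hpos hun hum hun,
      tsum_form_sub_right S.energyForm_symm hpos hun hum hum,
      tsum_form_comm S.energyForm_symm (u m) (u n)]
    ring
  have hkir := mul_nonneg hκ (kirchhoff_monotone S.gradForm_symm S.gradForm_self_nonneg
    (S.summable_gradForm_self ha hVp (hu n)) (S.summable_gradForm_self ha hVp (hu m)))
  simp only [← integral_gradSq, ← integral_gradDot] at hkir
  have hint : ∀ k, |S.integral fun x => f k x * (u n - u m) x| ≤ A * (β n + β m) := fun k => by
    have hadd : (fun x => b x * |(|u n x - w x| + |u m x - w x|)| * S.mu x) =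
        fun x => b x * |u n x - w x| * S.mu x + b x * |u m x - w x| * S.mu x := by
      funext x
      rw [abs_of_nonneg (add_nonneg (abs_nonneg _) (abs_nonneg _))]
      ring
    have h := S.abs_integral_mul_le (f := f k) (g := u n - u m)
      (h := fun x => |u n x - w x| + |u m x - w x|)
      (hadd ▸ (hβsum n).add (hβsum m)) (hf k) fun x => by
        rw [Pi.sub_apply, abs_of_nonneg (add_nonneg (abs_nonneg _) (abs_nonneg (u m x - w x))),
          abs_sub_comm (u m x)]
        exact abs_sub_le _ _ _
    rwa [hadd, (hβsum n).tsum_add (hβsum m)] at h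
  have hn := (le_abs_self _).trans ((hcrit n _ hφ).trans
    (mul_le_mul_of_nonneg_left hnorm (hε0 n)))
  have hm := (neg_le_abs _).trans ((hcrit m _ hφ).trans
    (mul_le_mul_of_nonneg_left hnorm (hε0 m)))
  have hin := (le_abs_self _).trans (hint n)
  have him := (neg_le_abs _).trans (hint m)
  rw [hQ]
  linarith

end Convergence

section Cerami

variable {V : Type*} (S : WeightedGraph V)

theorem PhiDeriv_smul (a₁ a₂ b₁ b₂ c : ℝ) (V₁ V₂ : V → ℝ) (Fs Ft : V → ℝ → ℝ → ℝ)
    (u v φ₁ φ₂ : V → ℝ) :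
    S.PhiDeriv a₁ a₂ b₁ b₂ V₁ V₂ Fs Ft u v (c • φ₁) (c • φ₂) =
      c * S.PhiDeriv a₁ a₂ b₁ b₂ V₁ V₂ Fs Ft u v φ₁ φ₂ := by
  have h : ∀ f φ : V → ℝ,
      (S.integral fun x => f x * (c • φ) x) = c * S.integral fun x => f x * φ x := fun f φ => by
    rw [integral, integral, ← tsum_mul_left]
    exact tsum_congr fun x => by rw [Pi.smul_apply, smul_eq_mul]; ring
  simp only [PhiDeriv, innerE_eq_tsum, integral_gradDot, h, map_smul, smul_eq_mul, tsum_mul_left]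
  ring

theorem PhiDeriv_zero_right (a₁ a₂ b₁ b₂ : ℝ) (V₁ V₂ : V → ℝ) (Fs Ft : V → ℝ → ℝ → ℝ)
    (u v φ : V → ℝ) :
    S.PhiDeriv a₁ a₂ b₁ b₂ V₁ V₂ Fs Ft u v φ 0 =
      S.innerE a₁ V₁ u φ + b₁ * S.integral (S.gradSq u) * S.integral (S.gradDot u φ)
        - S.integral fun x => Fs x (u x) (v x) * φ x := by
  rw [PhiDeriv, innerE_eq_tsum, innerE_eq_tsum, integral_gradDot, integral_gradDot]
  simp [integral]

theorem PhiDeriv_zero_left (a₁ a₂ b₁ b₂ : ℝ) (V₁ V₂ : V → ℝ) (Fs Ft : V → ℝ → ℝ → ℝ)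
    (u v φ : V → ℝ) :
    S.PhiDeriv a₁ a₂ b₁ b₂ V₁ V₂ Fs Ft u v 0 φ =
      S.innerE a₂ V₂ v φ + b₂ * S.integral (S.gradSq v) * S.integral (S.gradDot v φ)
        - S.integral fun x => Ft x (u x) (v x) * φ x := by
  rw [PhiDeriv, innerE_eq_tsum, innerE_eq_tsum, integral_gradDot, integral_gradDot]
  simp [integral]

variable {a₁ a₂ b₁ b₂ : ℝ} {V₁ V₂ : V → ℝ} {F Fs Ft : V → ℝ → ℝ → ℝ}

theorem CondF1.exists_bound {a : ℝ → ℝ} {b : V → ℝ} (hF1 : S.CondF1 F Fs Ft a b) (R : ℝ) :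
    ∃ A, ∀ x s t, |s| ≤ R → |t| ≤ R →
      |Fs x s t| ≤ A * b x ∧ |Ft x s t| ≤ A * b x ∧ |F x s t| ≤ A * b x := by
  obtain ⟨hcont, -, hb, -, hF⟩ := hF1
  obtain ⟨A, hA⟩ := (isCompact_Icc (a := (0 : ℝ)) (b := 2 * R)).exists_bound_of_continuousOn
    (hcont.mono Set.Icc_subset_Ici_self)
  refine ⟨A, fun x s t hs ht => ?_⟩
  have hsqrt : √(s ^ 2 + t ^ 2) ≤ 2 * R := by
    refine Real.sqrt_le_iff.2 ⟨by linarith [abs_nonneg s], ?_⟩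
    nlinarith [sq_abs s, sq_abs t, abs_nonneg s, abs_nonneg t]
  have ha : a (√(s ^ 2 + t ^ 2)) * b x ≤ A * b x :=
    mul_le_mul_of_nonneg_right ((le_abs_self _).trans (hA _ ⟨Real.sqrt_nonneg _, hsqrt⟩)) (hb x).le
  obtain ⟨h₁, h₂, h₃⟩ := hF x s t
  exact ⟨h₁.trans ha, h₂.trans ha, h₃.trans ha⟩

/-- `Φ(u, v) - ¼ ⟨Φ'(u, v), (u, v)⟩ ≥ ¼ ‖u‖² + ¼ ‖v‖²`. -/
theorem energy_le_Phi_sub_PhiDeriv {a : ℝ → ℝ} {b : V → ℝ} (hF1 : S.CondF1 F Fs Ft a b)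
    (hcurly : ∀ x s t, 0 ≤ curlyF (1 / 4) F Fs Ft x s t) {u v : V → ℝ} {R : ℝ}
    (hu : ∀ x, |u x| ≤ R) (hv : ∀ x, |v x| ≤ R) :
    1 / 4 * S.integral (S.energyDensity a₁ V₁ u) + 1 / 4 * S.integral (S.energyDensity a₂ V₂ v) ≤
      S.Phi a₁ a₂ b₁ b₂ V₁ V₂ F u v
        - 1 / 4 * S.PhiDeriv a₁ a₂ b₁ b₂ V₁ V₂ Fs Ft u v u v := by
  obtain ⟨A, hA⟩ := hF1.exists_bound S R
  have hb := hF1.2.2.2.1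
  have hs : Summable fun x => Fs x (u x) (v x) * u x * S.mu x :=
    S.summable_mul_of_bounded hb (fun x => (hA x _ _ (hu x) (hv x)).1) hu
  have ht : Summable fun x => Ft x (u x) (v x) * v x * S.mu x :=
    S.summable_mul_of_bounded hb (fun x => (hA x _ _ (hu x) (hv x)).2.1) hv
  have hF : Summable fun x => F x (u x) (v x) * S.mu x := by
    simpa using S.summable_mul_of_bounded (g := fun _ => 1) (R := 1) hb
      (fun x => (hA x _ _ (hu x) (hv x)).2.2) (fun x => by simp)
  have hint : 0 ≤ 1 / 4 * ((S.integral fun x => Fs x (u x) (v x) * u x)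
      + S.integral fun x => Ft x (u x) (v x) * v x) - S.integral fun x => F x (u x) (v x) := by
    simp only [integral]
    rw [← hs.tsum_add ht, ← tsum_mul_left, ← ((hs.add ht).mul_left _).tsum_sub hF]
    refine tsum_nonneg fun x => ?_
    have h := mul_nonneg (hcurly x (u x) (v x)) (S.mu_pos x).le
    rw [curlyF] at h
    linarith
  rw [Phi, PhiDeriv, innerE_self, innerE_self, integral_gradDot_self, integral_gradDot_self]
  linarith

theorem exists_abs_le_of_energy_le {a θ : ℝ} {Vp : V → ℝ} (ha : 0 ≤ a) (hθ : 0 < θ)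
    (hVp : ∀ x, θ ≤ Vp x) (M : ℝ) :
    ∃ R, ∀ u, S.memE a Vp u → S.integral (S.energyDensity a Vp u) ≤ M → ∀ x, |u x| ≤ R :=
  ⟨√(M / (θ * S.mumin)), fun _ hu hM x => Real.abs_le_sqrt ((S.sq_apply_le ha hθ hVp hu x).trans
    (div_le_div_of_nonneg_right hM (mul_pos hθ S.mumin_pos).le))⟩

theorem exists_common_bound {θ₁ θ₂ : ℝ} (ha₁ : 0 ≤ a₁) (ha₂ : 0 ≤ a₂) (hθ₁ : 0 < θ₁)
    (hθ₂ : 0 < θ₂) (hV₁ : ∀ x, θ₁ ≤ V₁ x) (hV₂ : ∀ x, θ₂ ≤ V₂ x) (M : ℝ) :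
    ∃ R, ∀ u v, S.memE a₁ V₁ u → S.memE a₂ V₂ v → S.integral (S.energyDensity a₁ V₁ u) ≤ M →
      S.integral (S.energyDensity a₂ V₂ v) ≤ M → ∀ x, |u x| ≤ R ∧ |v x| ≤ R := by
  obtain ⟨R₁, hR₁⟩ := S.exists_abs_le_of_energy_le ha₁ hθ₁ hV₁ M
  obtain ⟨R₂, hR₂⟩ := S.exists_abs_le_of_energy_le ha₂ hθ₂ hV₂ M
  exact ⟨max R₁ R₂, fun u v hu hv hMu hMv x => ⟨(hR₁ u hu hMu x).trans (le_max_left _ _),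
    (hR₂ v hv hMv x).trans (le_max_right _ _)⟩⟩

theorem abs_PhiDeriv_le {u v : V → ℝ} {ε : ℝ}
    (hε : ∀ φ₁ φ₂, S.memE a₁ V₁ φ₁ → S.memE a₂ V₂ φ₂ →
      S.normE a₁ V₁ φ₁ + S.normE a₂ V₂ φ₂ ≤ 1 →
      (1 + (S.normE a₁ V₁ u + S.normE a₂ V₂ v)) *
        |S.PhiDeriv a₁ a₂ b₁ b₂ V₁ V₂ Fs Ft u v φ₁ φ₂| ≤ ε)
    {φ₁ φ₂ : V → ℝ} (hφ₁ : S.memE a₁ V₁ φ₁) (hφ₂ : S.memE a₂ V₂ φ₂) :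
    (1 + (S.normE a₁ V₁ u + S.normE a₂ V₂ v)) *
        |S.PhiDeriv a₁ a₂ b₁ b₂ V₁ V₂ Fs Ft u v φ₁ φ₂| ≤
      ε * (1 + (S.normE a₁ V₁ φ₁ + S.normE a₂ V₂ φ₂)) := by
  set N := 1 + (S.normE a₁ V₁ φ₁ + S.normE a₂ V₂ φ₂) with hN
  have hN0 : 0 < N := add_pos_of_pos_of_nonneg one_pos
    (add_nonneg (Real.sqrt_nonneg _) (Real.sqrt_nonneg _))
  have h := hε (N⁻¹ • φ₁) (N⁻¹ • φ₂) (S.memE_smul _ hφ₁) (S.memE_smul _ hφ₂) (by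
    rw [normE_smul, normE_smul, abs_of_pos (inv_pos.2 hN0), ← mul_add, inv_mul_le_iff₀ hN0]
    linarith)
  rw [PhiDeriv_smul, abs_mul, abs_of_pos (inv_pos.2 hN0), mul_left_comm,
    inv_mul_le_iff₀ hN0] at h
  linarith

/-- Cerami sequences are bounded. -/
theorem CeramiSeq.exists_energy_le {a : ℝ → ℝ} {b : V → ℝ} {θ₁ θ₂ : ℝ}
    (ha₁ : 0 ≤ a₁) (ha₂ : 0 ≤ a₂) (hθ₁ : 0 < θ₁) (hθ₂ : 0 < θ₂) (hV₁ : ∀ x, θ₁ ≤ V₁ x)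
    (hV₂ : ∀ x, θ₂ ≤ V₂ x) (hF1 : S.CondF1 F Fs Ft a b)
    (hcurly : ∀ x s t, 0 ≤ curlyF (1 / 4) F Fs Ft x s t) {u v : ℕ → V → ℝ}
    (hcer : S.CeramiSeq a₁ a₂ b₁ b₂ V₁ V₂ F Fs Ft u v) :
    ∃ M, ∀ n, S.integral (S.energyDensity a₁ V₁ (u n)) ≤ M ∧
      S.integral (S.energyDensity a₂ V₂ (v n)) ≤ M := by
  obtain ⟨hmem, ⟨C, hC⟩, ε, hε, hcrit⟩ := hcer
  obtain ⟨D, hD⟩ := hε.bddAbove_range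
  refine ⟨4 * C + D, fun n => ?_⟩
  have hQu := S.integral_energyDensity_nonneg ha₁ (fun x => hθ₁.le.trans (hV₁ x)) (u n)
  have hQv := S.integral_energyDensity_nonneg ha₂ (fun x => hθ₂.le.trans (hV₂ x)) (v n)
  obtain ⟨R, hR⟩ := S.exists_common_bound ha₁ ha₂ hθ₁ hθ₂ hV₁ hV₂
    (S.integral (S.energyDensity a₁ V₁ (u n)) + S.integral (S.energyDensity a₂ V₂ (v n)))
  have hR := hR _ _ (hmem n).1 (hmem n).2 (by linarith) (by linarith)
  have hN0 : 0 < 1 + (S.normE a₁ V₁ (u n) + S.normE a₂ V₂ (v n)) :=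
    add_pos_of_pos_of_nonneg one_pos (add_nonneg (Real.sqrt_nonneg _) (Real.sqrt_nonneg _))
  have hder : |S.PhiDeriv a₁ a₂ b₁ b₂ V₁ V₂ Fs Ft (u n) (v n) (u n) (v n)| ≤ ε n := by
    have h := S.abs_PhiDeriv_le (hcrit n) (hmem n).1 (hmem n).2
    rw [mul_comm (ε n)] at h
    exact le_of_mul_le_mul_left h hN0
  have hle := S.energy_le_Phi_sub_PhiDeriv (a₁ := a₁) (a₂ := a₂) (b₁ := b₁) (b₂ := b₂)
    (V₁ := V₁) (V₂ := V₂) hF1 hcurly (fun x => (hR x).1) (fun x => (hR x).2)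
  have h₁ := (le_abs_self _).trans (hC n)
  have h₂ := (neg_le_abs _).trans hder
  have h₃ := hD (Set.mem_range_self n)
  constructor <;> linarith

/-- Uniformly bounded sequences of pairs of functions on a countable set have pointwise
convergent subsequences. -/
theorem exists_subseq_tendsto_pointwise [Countable V] {u v : ℕ → V → ℝ} {R : ℝ}
    (h : ∀ n x, |u n x| ≤ R ∧ |v n x| ≤ R) :
    ∃ ns : ℕ → ℕ, StrictMono ns ∧ ∃ ulim vlim : V → ℝ,
      (∀ x, Tendsto (fun j => u (ns j) x) atTop (𝓝 (ulim x))) ∧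
      ∀ x, Tendsto (fun j => v (ns j) x) atTop (𝓝 (vlim x)) := by
  have hK : IsCompact (Set.univ.pi fun _ : V => Set.Icc (-R) R) :=
    isCompact_univ_pi fun _ => isCompact_Icc
  obtain ⟨p, -, ns, hns, hp⟩ := (hK.prod hK).tendsto_subseq (x := fun n => (u n, v n))
    fun n => ⟨fun x _ => abs_le.1 (h n x).1, fun x _ => abs_le.1 (h n x).2⟩
  exact ⟨ns, hns, p.1, p.2, tendsto_pi_nhds.1 ((continuous_fst.tendsto p).comp hp),
    tendsto_pi_nhds.1 ((continuous_snd.tendsto p).comp hp)⟩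

end Cerami

end WeightedGraph

/-- Lemma 3.2: under `b₁, b₂ > 0`, (V), (F₀), (F₁), (F₂), (F₃), (F₄), every Cerami
sequence for `Φ` has a subsequence converging in the norm of `E`. -/
theorem cerami_sequence_convergent_F4
    {V : Type*} (S : WeightedGraph V)
    (a₁ a₂ b₁ b₂ : ℝ) (ha₁ : 0 < a₁) (ha₂ : 0 < a₂) (hb₁ : 0 < b₁) (hb₂ : 0 < b₂)
    (V₁ V₂ : V → ℝ) (θ₁ θ₂ : ℝ) (hV : S.CondV V₁ V₂ θ₁ θ₂)
    (F Fs Ft : V → ℝ → ℝ → ℝ) (hFder : IsPartialDerivs F Fs Ft)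
    (a : ℝ → ℝ) (b : V → ℝ) (r₀ : ℝ) (hr₀ : 0 < r₀)
    (hF0 : CondF0 F) (hF1 : S.CondF1 F Fs Ft a b)
    (hF2 : CondF2 F) (hF3 : CondF3 F r₀) (hF4 : CondF4 F Fs Ft r₀)
    (u v : ℕ → V → ℝ)
    (hcer : S.CeramiSeq a₁ a₂ b₁ b₂ V₁ V₂ F Fs Ft u v) :
    ∃ ns : ℕ → ℕ, StrictMono ns ∧ ∃ ulim vlim : V → ℝ,
      S.memE a₁ V₁ ulim ∧ S.memE a₂ V₂ vlim ∧
      Tendsto (fun j => S.normE a₁ V₁ (fun x => u (ns j) x - ulim x)) atTop (nhds 0) ∧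
      Tendsto (fun j => S.normE a₂ V₂ (fun x => v (ns j) x - vlim x)) atTop (nhds 0) := by
  obtain ⟨hglb₁, hglb₂, hθ₁, hθ₂, -⟩ := hV
  have hV₁ : ∀ x, θ₁ ≤ V₁ x := fun x => hglb₁.1 (Set.mem_range_self x)
  have hV₂ : ∀ x, θ₂ ≤ V₂ x := fun x => hglb₂.1 (Set.mem_range_self x)
  obtain ⟨M, hM⟩ := hcer.exists_energy_le S ha₁.le ha₂.le hθ₁ hθ₂ hV₁ hV₂ hF1 hF4.1
  obtain ⟨R, hR⟩ := S.exists_common_bound ha₁.le ha₂.le hθ₁ hθ₂ hV₁ hV₂ M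
  obtain ⟨A, hA⟩ := hF1.exists_bound S R
  obtain ⟨-, -, hb0, hb, -⟩ := hF1
  obtain ⟨hmem, -, ε, hε, hcrit⟩ := hcer
  have hR : ∀ n x, |u n x| ≤ R ∧ |v n x| ≤ R := fun n =>
    hR _ _ (hmem n).1 (hmem n).2 (hM n).1 (hM n).2
  have hA : ∀ n x, _ := fun n x => hA x _ _ (hR n x).1 (hR n x).2
  have : Countable V := by
    have h := hb.countable_support
    rwa [Function.support_eq_univ fun x => (mul_pos (hb0 x) (S.mu_pos x)).ne',
      Set.countable_univ_iff] at h
  obtain ⟨ns, hns, ulim, vlim, hul, hvl⟩ := exists_subseq_tendsto_pointwise hR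
  have hε' : Tendsto (fun j => ε (ns j)) atTop (𝓝 0) := hε.comp hns.tendsto_atTop
  have hcrit' : ∀ n φ₁ φ₂, S.memE a₁ V₁ φ₁ → S.memE a₂ V₂ φ₂ →
      |S.PhiDeriv a₁ a₂ b₁ b₂ V₁ V₂ Fs Ft (u n) (v n) φ₁ φ₂| ≤
        ε n * (1 + (S.normE a₁ V₁ φ₁ + S.normE a₂ V₂ φ₂)) := fun n φ₁ φ₂ h₁ h₂ =>
    (le_mul_of_one_le_left (abs_nonneg _) (le_add_of_nonneg_right
      (add_nonneg (Real.sqrt_nonneg _) (Real.sqrt_nonneg _)))).trans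
        (S.abs_PhiDeriv_le (hcrit n) h₁ h₂)
  obtain ⟨hu, hul'⟩ := S.tendsto_normE_of_almost_critical
    (f := fun j x => Fs x (u (ns j) x) (v (ns j) x)) ha₁ hb₁.le
    (fun x => hθ₁.le.trans (hV₁ x)) (fun x => (hb0 x).le) hb (fun j => (hmem (ns j)).1)
    (fun j => (hM (ns j)).1) (fun j x => (hR (ns j) x).1) (fun j x => (hA (ns j) x).1) hε' hul
    fun j φ hφ => by
      have h := hcrit' (ns j) φ 0 hφ S.memE_zero
      rwa [S.PhiDeriv_zero_right, S.normE_zero, add_zero] at h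
  obtain ⟨hv, hvl'⟩ := S.tendsto_normE_of_almost_critical
    (f := fun j x => Ft x (u (ns j) x) (v (ns j) x)) ha₂ hb₂.le
    (fun x => hθ₂.le.trans (hV₂ x)) (fun x => (hb0 x).le) hb (fun j => (hmem (ns j)).2)
    (fun j => (hM (ns j)).2) (fun j x => (hR (ns j) x).2) (fun j x => (hA (ns j) x).2.1) hε' hvl
    fun j φ hφ => by
      have h := hcrit' (ns j) 0 φ S.memE_zero hφ
      rwa [S.PhiDeriv_zero_left, S.normE_zero, zero_add] at h
  exact ⟨ns, hns, ulim, vlim, hu, hv, hul', hvl'⟩
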